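/- Let G be a finite graph with a percolation measure and let a₁, a₂, a₃, b be vertices. Then max over j∈{1,2} of P({a₁,a₂} is pivotal for the event aⱼ↔b) ≥ P({a₁,a₂} is pivotal for the event a₃↔b). -/

import Mathlib

open scoped BigOperators

structure PercGraph (V E : Type) where
  ends : E → V × V
  p : E → ℝ

namespace PercGraph

variable {V E : Type} [DecidableEq V] [Fintype E] [DecidableEq E]

/-- Weight of a configuration: each edge `e` is open (`ω e = true`) with probability `p e`. -/
def weight (G : PercGraph V E) (ω : E → Bool) : ℝ :=
  ∏ e, if ω e then G.p e else 1 - G.p e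

/-- Probability of an event under the percolation measure. -/
noncomputable def prob (G : PercGraph V E) (S : Set (E → Bool)) : ℝ :=
  ∑ ω : E → Bool, Set.indicator S G.weight ω

/-- Expectation of a function under the percolation measure. -/
noncomputable def expec (G : PercGraph V E) (f : (E → Bool) → ℝ) : ℝ :=
  ∑ ω : E → Bool, f ω * G.weight ω

/-- Two vertices are adjacent via an open edge in configuration `ω`. -/
def adj (G : PercGraph V E) (ω : E → Bool) (x y : V) : Prop :=
  ∃ e, ω e = true ∧ (G.ends e = (x, y) ∨ G.ends e = (y, x))

/-- `x` and `y` are connected by a path of open edges. -/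
def Conn (G : PercGraph V E) (ω : E → Bool) (x y : V) : Prop :=
  Relation.ReflTransGen (G.adj ω) x y

/-- The union of the open clusters of the vertices of `A`. -/
def cluster (G : PercGraph V E) (ω : E → Bool) (A : Set V) : Set V :=
  {y | ∃ a ∈ A, G.Conn ω a y}

/-- The event `x ↔ y`. -/
def connEvent (G : PercGraph V E) (x y : V) : Set (E → Bool) :=
  {ω | G.Conn ω x y}

/-- The event `x ↔ A`. -/
def connTo (G : PercGraph V E) (x : V) (A : Set V) : Set (E → Bool) :=
  {ω | ∃ a ∈ A, G.Conn ω x a}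

/-- The event `A ↮ B`. -/
def disconn (G : PercGraph V E) (A B : Set V) : Set (E → Bool) :=
  {ω | ∀ a ∈ A, ∀ b ∈ B, ¬ G.Conn ω a b}

def IncreasingEvent (S : Set (E → Bool)) : Prop :=
  ∀ ⦃ω ω' : E → Bool⦄, (∀ e, ω e = true → ω' e = true) → ω ∈ S → ω' ∈ S

def DecreasingEvent (S : Set (E → Bool)) : Prop :=
  ∀ ⦃ω ω' : E → Bool⦄, (∀ e, ω e = true → ω' e = true) → ω' ∈ S → ω ∈ S

def IncreasingFun (f : (E → Bool) → ℝ) : Prop :=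
  ∀ ⦃ω ω' : E → Bool⦄, (∀ e, ω e = true → ω' e = true) → f ω ≤ f ω'

/-- `f` is determined by the cluster of `A`. -/
def ClusterDetermined (G : PercGraph V E) (A : Set V) (f : (E → Bool) → ℝ) : Prop :=
  ∀ ω ω', G.cluster ω A = G.cluster ω' A → f ω = f ω'

/-- The event `S` is determined by the cluster of `A`. -/
def ClusterDeterminedEvent (G : PercGraph V E) (A : Set V) (S : Set (E → Bool)) : Prop :=
  ∀ ω ω', G.cluster ω A = G.cluster ω' A → (ω ∈ S ↔ ω' ∈ S)

noncomputable def condProb (G : PercGraph V E) (S T : Set (E → Bool)) : ℝ :=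
  G.prob (S ∩ T) / G.prob T

noncomputable def condExpec (G : PercGraph V E) (f : (E → Bool) → ℝ) (T : Set (E → Bool)) : ℝ :=
  G.expec (T.indicator f) / G.prob T

/-- The edge `e` is incident to the vertex `x`. -/
def incident (G : PercGraph V E) (x : V) (e : E) : Prop :=
  (G.ends e).1 = x ∨ (G.ends e).2 = x

/-- The other endpoint of an edge incident to `x`. -/
def otherEnd (G : PercGraph V E) (x : V) (e : E) : V :=
  if (G.ends e).1 = x then (G.ends e).2 else (G.ends e).1

/-- The graph `G ∖ W`: delete the vertices of `W` and all incident edges. -/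
def delete (G : PercGraph V E) (W : Finset V) :
    PercGraph V {e : E // (G.ends e).1 ∉ W ∧ (G.ends e).2 ∉ W} :=
  ⟨fun e => G.ends e.1, fun e => G.p e.1⟩

/-- The graph `G` with the probability of edge `e` replaced by `q`. -/
def withEdgeProb (G : PercGraph V E) (e : E) (q : ℝ) : PercGraph V E :=
  ⟨G.ends, Function.update G.p e q⟩

/-- Contraction of the edge `e`: set its probability to 1. -/
def contract (G : PercGraph V E) (e : E) : PercGraph V E :=
  G.withEdgeProb e 1

/-- The event that `e` is pivotal for `U`. -/
def pivotal (e : E) (U : Set (E → Bool)) : Set (E → Bool) :=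
  {ω | ¬ ((Function.update ω e true ∈ U) ↔ (Function.update ω e false ∈ U))}

/-- All edge probabilities lie in `[0,1]`. -/
def ProbValid (G : PercGraph V E) : Prop := ∀ e, 0 ≤ G.p e ∧ G.p e ≤ 1

end PercGraph

namespace PercGraph

variable {V E : Type}

section Prob

variable [Fintype E] {G : PercGraph V E}

lemma weight_nonneg (hp : G.ProbValid) (ω : E → Bool) : 0 ≤ G.weight ω := by
  refine Finset.prod_nonneg fun e _ => ?_
  have := hp e
  split_ifs <;> linarith

variable [DecidableEq E]

lemma prob_nonneg (hp : G.ProbValid) (S : Set (E → Bool)) : 0 ≤ G.prob S :=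
  Finset.sum_nonneg fun ω _ => Set.indicator_nonneg (fun ω _ => weight_nonneg hp ω) ω

lemma prob_mono (hp : G.ProbValid) {S T : Set (E → Bool)} (h : S ⊆ T) : G.prob S ≤ G.prob T :=
  Finset.sum_le_sum fun ω _ =>
    Set.indicator_le_indicator_of_subset h (fun ω => weight_nonneg hp ω) ω

lemma prob_inter_add_diff (S T : Set (E → Bool)) :
    G.prob (S ∩ T) + G.prob (S \ T) = G.prob S := by
  classical
  unfold prob
  rw [← Finset.sum_add_distrib]
  refine Finset.sum_congr rfl fun ω _ => ?_
  simp only [Set.indicator_apply, Set.mem_inter_iff, Set.mem_sdiff]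
  by_cases h₁ : ω ∈ S <;> by_cases h₂ : ω ∈ T <;> simp [h₁, h₂]

lemma prob_union_le (hp : G.ProbValid) (S T : Set (E → Bool)) :
    G.prob (S ∪ T) ≤ G.prob S + G.prob T := by
  rw [← prob_inter_add_diff (S ∪ T) S]
  exact add_le_add (prob_mono hp Set.inter_subset_right)
    (prob_mono hp fun ω h => h.1.resolve_left h.2)

/-- Conditioning on the state of the edge `e`. -/
lemma prob_eq_condition_edge (e : E) (S : Set (E → Bool)) :
    G.prob S = G.p e * G.prob {ω | Function.update ω e true ∈ S}
      + (1 - G.p e) * G.prob {ω | Function.update ω e false ∈ S} := by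
  classical
  have hw (b : Bool) (η : {j // j ≠ e} → Bool) :
      G.weight ((Equiv.funSplitAt e Bool).symm (b, η)) =
        (if b then G.p e else 1 - G.p e) *
          ∏ j : {j // j ≠ e}, if η j then G.p j else 1 - G.p j := by
    unfold weight
    rw [Fintype.prod_eq_mul_prod_subtype_ne _ e]
    congr 1
    · simp [Equiv.funSplitAt, Equiv.piSplitAt]
    · refine Finset.prod_congr rfl fun j _ => ?_
      simp [Equiv.funSplitAt, Equiv.piSplitAt, j.2]
  have hu (b c : Bool) (η : {j // j ≠ e} → Bool) :
      Function.update ((Equiv.funSplitAt e Bool).symm (b, η)) e c =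
        (Equiv.funSplitAt e Bool).symm (c, η) := by
    ext j
    by_cases h : j = e
    · subst h; simp [Equiv.funSplitAt, Equiv.piSplitAt]
    · simp [Equiv.funSplitAt, Equiv.piSplitAt, h]
  have hs (f : (E → Bool) → ℝ) : ∑ ω, f ω =
      ∑ η : {j // j ≠ e} → Bool, (f ((Equiv.funSplitAt e Bool).symm (true, η))
        + f ((Equiv.funSplitAt e Bool).symm (false, η))) := by
    rw [← (Equiv.funSplitAt e Bool).symm.sum_comp, Fintype.sum_prod_type, Fintype.sum_bool,
      Finset.sum_add_distrib]
  unfold prob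
  rw [hs, hs, hs, Finset.mul_sum, Finset.mul_sum, ← Finset.sum_add_distrib]
  refine Finset.sum_congr rfl fun η _ => ?_
  simp only [Set.indicator_apply, Set.mem_ofPred_eq, hu, hw]
  by_cases h₁ : (Equiv.funSplitAt e Bool).symm (true, η) ∈ S <;>
    by_cases h₂ : (Equiv.funSplitAt e Bool).symm (false, η) ∈ S <;>
    simp only [h₁, h₂, if_true, if_false, Bool.false_eq_true] <;> ring

lemma prob_univ : G.prob Set.univ = 1 := by
  simp only [prob, Set.indicator_univ, weight]
  rw [← Fintype.prod_sum (fun e (b : Bool) => if b then G.p e else 1 - G.p e)]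
  simp

end Prob

section Cluster

variable (G : PercGraph V E)

/-- `e` joins `v` and `w`. -/
def Joins (e : E) (v w : V) : Prop := G.ends e = (v, w) ∨ G.ends e = (w, v)

/-- Close all edges outside `F`. -/
def restrict [DecidableEq E] (F : Finset E) (ω : E → Bool) : E → Bool := fun e => decide (e ∈ F) && ω e

variable {G}

lemma Conn.symm {ω : E → Bool} {x y : V} (h : G.Conn ω x y) : G.Conn ω y x :=
  haveI : Std.Symm (G.adj ω) := ⟨fun _ _ ⟨e, he, h⟩ => ⟨e, he, h.symm⟩⟩
  Relation.ReflTransGen.stdSymm.symm _ _ h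

lemma Conn.mono {ω ω' : E → Bool} (hω : ∀ e, ω e = true → ω' e = true) {x y : V}
    (h : G.Conn ω x y) : G.Conn ω' x y :=
  Relation.ReflTransGen.mono (p := G.adj ω') (fun _ _ ⟨e, he, h⟩ => ⟨e, hω e he, h⟩) _ _ h

lemma mem_cluster_singleton {ω : E → Bool} {x y : V} : y ∈ G.cluster ω {x} ↔ G.Conn ω x y := by
  simp [cluster]

lemma cluster_mono {ω : E → Bool} {X Y : Set V} (h : X ⊆ Y) : G.cluster ω X ⊆ G.cluster ω Y :=
  fun _ ⟨x, hx, hc⟩ => ⟨x, h hx, hc⟩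

lemma cluster_mono_config {ω ω' : E → Bool} (hω : ∀ e, ω e = true → ω' e = true) (X : Set V) :
    G.cluster ω X ⊆ G.cluster ω' X :=
  fun _ ⟨x, hx, hc⟩ => ⟨x, hx, hc.mono hω⟩

lemma subset_cluster (ω : E → Bool) (X : Set V) : X ⊆ G.cluster ω X :=
  fun x hx => ⟨x, hx, Relation.ReflTransGen.refl⟩

lemma cluster_union (ω : E → Bool) (X Y : Set V) :
    G.cluster ω (X ∪ Y) = G.cluster ω X ∪ G.cluster ω Y := by
  ext y
  simp only [cluster, Set.mem_union, Set.mem_ofPred_eq, or_and_right, exists_or]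

/-- A set closed under open edges contains the clusters of its points. -/
lemma cluster_subset_of_closed {ω : E → Bool} {X S : Set V} (hX : X ⊆ S)
    (hS : ∀ y ∈ S, ∀ z, G.adj ω y z → z ∈ S) : G.cluster ω X ⊆ S := by
  rintro y ⟨x, hx, hc⟩
  induction hc with
  | refl => exact hX hx
  | tail _ h ih => exact hS _ ih _ h

lemma mem_cluster_of_adj {ω : E → Bool} {X : Set V} {y z : V} (hy : y ∈ G.cluster ω X)
    (h : G.adj ω y z) : z ∈ G.cluster ω X :=
  let ⟨x, hx, hc⟩ := hy
  ⟨x, hx, hc.tail h⟩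

variable [DecidableEq E]

lemma le_update_true (ω : E → Bool) (e f : E) (h : ω f = true) :
    Function.update ω e true f = true := by
  by_cases hf : f = e <;> simp [hf, h]

lemma adj_update_true {ω : E → Bool} {e : E} {v w y z : V} (he : G.Joins e v w)
    (h : G.adj (Function.update ω e true) y z) :
    G.adj ω y z ∨ y = v ∧ z = w ∨ y = w ∧ z = v := by
  obtain ⟨f, hf, hyz⟩ := h
  by_cases hfe : f = e
  · subst hfe
    right
    rcases he with he | he <;> rcases hyz with hyz | hyz <;>
      simp_all [Prod.ext_iff]
  · exact Or.inl ⟨f, by simpa [hfe] using hf, hyz⟩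

lemma cluster_update_true {ω : E → Bool} {e : E} {v w : V} (he : G.Joins e v w) {X : Set V}
    (hv : v ∈ X) :
    G.cluster (Function.update ω e true) X = G.cluster ω (insert w X) := by
  apply Set.Subset.antisymm
  · refine cluster_subset_of_closed
      ((Set.subset_insert w X).trans (subset_cluster ω _)) fun y hy z h => ?_
    rcases adj_update_true he h with h | ⟨-, rfl⟩ | ⟨-, rfl⟩
    · exact mem_cluster_of_adj hy h
    · exact subset_cluster _ _ (Set.mem_insert _ _)
    · exact subset_cluster _ _ (Set.mem_insert_of_mem _ hv)
  · refine cluster_subset_of_closed (Set.insert_subset ?_ (subset_cluster _ X)) fun y hy z h => ?_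
    · exact mem_cluster_of_adj (subset_cluster _ _ hv) ⟨e, by simp, he⟩
    · obtain ⟨f, hf, hyz⟩ := h
      exact mem_cluster_of_adj hy ⟨f, le_update_true ω e f hf, hyz⟩

lemma conn_update_true {ω : E → Bool} {e : E} {v w : V} (he : G.Joins e v w) {x y : V}
    (h : G.Conn (Function.update ω e true) x y) :
    G.Conn ω x y ∨ G.Conn ω v x ∧ G.Conn ω w y ∨ G.Conn ω w x ∧ G.Conn ω v y := by
  induction h with
  | refl => exact Or.inl .refl
  | @tail y z _ h ih =>
    rcases adj_update_true he h with h | ⟨rfl, rfl⟩ | ⟨rfl, rfl⟩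
    · rcases ih with ih | ih | ih
      · exact Or.inl (ih.tail h)
      · exact Or.inr (Or.inl ⟨ih.1, ih.2.tail h⟩)
      · exact Or.inr (Or.inr ⟨ih.1, ih.2.tail h⟩)
    · rcases ih with ih | ih | ih
      · exact Or.inr (Or.inl ⟨ih.symm, .refl⟩)
      · exact Or.inr (Or.inl ⟨ih.1, .refl⟩)
      · exact Or.inl ih.1.symm
    · rcases ih with ih | ih | ih
      · exact Or.inr (Or.inr ⟨ih.symm, .refl⟩)
      · exact Or.inl ih.1.symm
      · exact Or.inr (Or.inr ⟨ih.1, .refl⟩)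

lemma restrict_update_true {F : Finset E} {e : E} (he : e ∈ F) (ω : E → Bool) :
    restrict F (Function.update ω e true) = Function.update (restrict (F.erase e) ω) e true := by
  ext f
  by_cases hf : f = e <;> simp [restrict, hf, he]

lemma restrict_update_false (F : Finset E) (e : E) (ω : E → Bool) :
    restrict F (Function.update ω e false) = restrict (F.erase e) ω := by
  ext f
  by_cases hf : f = e <;> simp [restrict, hf]

lemma restrict_mono {F F' : Finset E} (h : F ⊆ F') (ω : E → Bool) (e : E)
    (he : restrict F ω e = true) : restrict F' ω e = true := by
  simp only [restrict, Bool.and_eq_true, decide_eq_true_eq] at he ⊢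
  exact ⟨h he.1, he.2⟩

lemma cluster_restrict_eq_self {F : Finset E} {X : Set V}
    (hX : ∀ e ∈ F, ∀ v ∈ X, ∀ w, ¬ G.Joins e v w) (ω : E → Bool) :
    G.cluster (restrict F ω) X = X := by
  refine Set.Subset.antisymm (cluster_subset_of_closed subset_rfl ?_) (subset_cluster _ _)
  rintro y hy z ⟨e, he, hyz⟩
  simp only [restrict, Bool.and_eq_true, decide_eq_true_eq] at he
  exact absurd hyz (hX e he.1 y hy z)

/-- Conditioning on an edge of `F` at a point of the two sets whose clusters are considered. -/
lemma prob_restrict_cluster [Fintype E] {F : Finset E} {e : E} (heF : e ∈ F) {v w : V} (he : G.Joins e v w)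
    (P : Set V → Set V → Prop) {X Y : Set V} (hX : v ∈ X) (hY : v ∈ Y) :
    G.prob {ω | P (G.cluster (restrict F ω) X) (G.cluster (restrict F ω) Y)} =
      G.p e * G.prob {ω | P (G.cluster (restrict (F.erase e) ω) (insert w X))
        (G.cluster (restrict (F.erase e) ω) (insert w Y))} +
      (1 - G.p e) * G.prob {ω | P (G.cluster (restrict (F.erase e) ω) X)
        (G.cluster (restrict (F.erase e) ω) Y)} := by
  rw [prob_eq_condition_edge e]
  simp only [Set.mem_ofPred_eq, restrict_update_true heF, restrict_update_false,
    cluster_update_true he hX, cluster_update_true he hY]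

end Cluster

/-- The four functions inequality on a two-point lattice with weights `p`, `q`. -/
lemma four_functions_two_point {p q a₀ a₁ b₀ b₁ c₀ c₁ d₀ d₁ : ℝ} (hp : 0 ≤ p) (hq : 0 ≤ q)
    (ha₁ : 0 ≤ a₁) (hb₁ : 0 ≤ b₁)
    (hc₀ : 0 ≤ c₀) (hc₁ : 0 ≤ c₁) (hd₀ : 0 ≤ d₀) (hd₁ : 0 ≤ d₁)
    (h₀₀ : a₀ * b₀ ≤ c₀ * d₀) (h₁₀ : a₁ * b₀ ≤ c₁ * d₀) (h₀₁ : a₀ * b₁ ≤ c₁ * d₀)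
    (h₁₁ : a₁ * b₁ ≤ c₁ * d₁) :
    (p * a₁ + q * a₀) * (p * b₁ + q * b₀) ≤ (p * c₁ + q * c₀) * (p * d₁ + q * d₀) := by
  have key : a₁ * b₀ + a₀ * b₁ ≤ c₁ * d₀ + c₀ * d₁ := by
    rcases (mul_nonneg hc₁ hd₀).eq_or_lt with h | h
    · have := mul_nonneg hc₀ hd₁
      linarith
    · have hprod : (a₁ * b₀) * (a₀ * b₁) ≤ (c₁ * d₀) * (c₀ * d₁) := by
        calc (a₁ * b₀) * (a₀ * b₁) = (a₀ * b₀) * (a₁ * b₁) := by ring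
          _ ≤ (c₀ * d₀) * (c₁ * d₁) := by gcongr
          _ = _ := by ring
      refine le_of_mul_le_mul_left ?_ h
      nlinarith [mul_nonneg (sub_nonneg.2 h₁₀) (sub_nonneg.2 h₀₁)]
  have e₁ := mul_le_mul_of_nonneg_left h₁₁ (mul_nonneg hp hp)
  have e₂ := mul_le_mul_of_nonneg_left h₀₀ (mul_nonneg hq hq)
  have e₃ := mul_le_mul_of_nonneg_left key (mul_nonneg hp hq)
  linarith

variable [Fintype E] [DecidableEq E] {G : PercGraph V E}

/-- A van den Berg–Kahn type inequality for clusters with sources `X` and `Y`, conditioned not to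
contain `b`. -/
theorem prob_cluster_mul_le (hp : G.ProbValid) (b c d : V) (F : Finset E) (X Y : Set V) :
    G.prob {ω | c ∈ G.cluster (restrict F ω) X ∧ b ∉ G.cluster (restrict F ω) X} *
        G.prob {ω | b ∉ G.cluster (restrict F ω) (insert d Y)} ≤
      G.prob {ω | c ∈ G.cluster (restrict F ω) (X ∪ Y) ∧
          b ∉ G.cluster (restrict F ω) (insert d (X ∪ Y))} *
        G.prob {ω | b ∉ G.cluster (restrict F ω) (X ∩ Y)} := by
  induction F using Finset.strongInduction generalizing X Y with
  | H F ih =>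
  by_cases hbX : b ∈ X
  · have : {ω | c ∈ G.cluster (restrict F ω) X ∧ b ∉ G.cluster (restrict F ω) X} = ∅ :=
      Set.eq_empty_of_forall_notMem fun ω h => h.2 (subset_cluster _ _ hbX)
    rw [this]
    simpa [prob] using mul_nonneg (prob_nonneg hp _) (prob_nonneg hp _)
  by_cases hXY : ∃ e ∈ F, ∃ v ∈ X ∩ Y, ∃ w, G.Joins e v w
  · obtain ⟨e, heF, v, hv, w, he⟩ := hXY
    have ih := ih (F.erase e) (Finset.erase_ssubset heF)
    have hd {z : V} {S : Set V} (h : z ∈ S) : z ∈ insert d S := Set.mem_insert_of_mem d h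
    rw [prob_restrict_cluster heF he (fun S _ => c ∈ S ∧ b ∉ S) hv.1 hv.1,
      prob_restrict_cluster heF he (fun S _ => b ∉ S) (hd hv.2) (hd hv.2),
      prob_restrict_cluster heF he (fun S T => c ∈ S ∧ b ∉ T) (X := X ∪ Y)
        (Or.inl hv.1) (hd (Or.inl hv.1)),
      prob_restrict_cluster heF he (fun S _ => b ∉ S) hv hv]
    have hanti {S T : Set V} (h : S ⊆ T) :
        G.prob {ω | b ∉ G.cluster (restrict (F.erase e) ω) T} ≤
          G.prob {ω | b ∉ G.cluster (restrict (F.erase e) ω) S} :=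
      prob_mono hp fun ω hω hb => hω (cluster_mono h hb)
    have h₁₀ := ih (insert w X) Y
    have h₀₁ := ih X (insert w Y)
    have h₁₁ := ih (insert w X) (insert w Y)
    rw [Set.insert_union] at h₁₀
    rw [Set.union_insert] at h₀₁
    rw [← Set.insert_inter_distrib, ← Set.insert_union_distrib, Set.insert_comm d w,
      Set.insert_comm d w] at h₁₁
    rw [Set.insert_comm d w] at h₁₀ h₀₁
    rw [Set.insert_comm d w] at h₀₁
    refine four_functions_two_point (hp e).1 (sub_nonneg.2 (hp e).2)
      (prob_nonneg hp _) (prob_nonneg hp _)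
      (prob_nonneg hp _) (prob_nonneg hp _) (prob_nonneg hp _) (prob_nonneg hp _)
      (ih X Y) (h₁₀.trans ?_) (h₀₁.trans ?_) h₁₁
    · exact mul_le_mul_of_nonneg_left
        (hanti (Set.inter_subset_inter_left _ (Set.subset_insert _ _))) (prob_nonneg hp _)
    · exact mul_le_mul_of_nonneg_left
        (hanti (Set.inter_subset_inter_right _ (Set.subset_insert _ _))) (prob_nonneg hp _)
  push Not at hXY
  have hone : {ω | b ∉ G.cluster (restrict F ω) (X ∩ Y)} = Set.univ := by
    refine Set.eq_univ_of_forall fun ω => ?_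
    rw [Set.mem_ofPred_eq, cluster_restrict_eq_self hXY]
    exact fun h => hbX h.1
  rw [hone, prob_univ, mul_one]
  have hle (S : Set (E → Bool)) : G.prob S ≤ 1 :=
    prob_univ (G := G) ▸ prob_mono hp (Set.subset_univ S)
  by_cases hX : ∃ e ∈ F, ∃ v ∈ X, ∃ w, G.Joins e v w
  · obtain ⟨e, heF, v, hv, w, he⟩ := hX
    have ih (X' : Set V) := (ih (F.erase e) (Finset.erase_ssubset heF) X' Y).trans
      (mul_le_of_le_one_right (prob_nonneg hp _) (hle _))
    have hmono : G.prob {ω | b ∉ G.cluster (restrict F ω) (insert d Y)} ≤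
        G.prob {ω | b ∉ G.cluster (restrict (F.erase e) ω) (insert d Y)} :=
      prob_mono hp fun ω hω hb =>
        hω (cluster_mono_config (restrict_mono (Finset.erase_subset e F) ω) _ hb)
    refine (mul_le_mul_of_nonneg_left hmono (prob_nonneg hp _)).trans ?_
    rw [prob_restrict_cluster heF he (fun S _ => c ∈ S ∧ b ∉ S) hv hv,
      prob_restrict_cluster heF he (fun S T => c ∈ S ∧ b ∉ T) (X := X ∪ Y)
        (Or.inl hv) (Set.mem_insert_of_mem d (Or.inl hv)), add_mul, mul_assoc, mul_assoc]
    have h₁ := ih (insert w X)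
    rw [Set.insert_union, Set.insert_comm d w] at h₁
    exact add_le_add (mul_le_mul_of_nonneg_left h₁ (hp e).1)
      (mul_le_mul_of_nonneg_left (ih X) (sub_nonneg.2 (hp e).2))
  · push Not at hX
    by_cases hcX : c ∈ X
    · refine (mul_le_of_le_one_left (prob_nonneg hp _) (hle _)).trans
        (prob_mono hp fun ω hω => ⟨subset_cluster _ _ (Or.inl hcX), ?_⟩)
      rw [← Set.union_insert, cluster_union, cluster_restrict_eq_self hX]
      exact fun h => h.elim hbX hω
    · have : {ω | c ∈ G.cluster (restrict F ω) X ∧ b ∉ G.cluster (restrict F ω) X} = ∅ := by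
        refine Set.eq_empty_of_forall_notMem fun ω h => ?_
        rw [Set.mem_ofPred_eq, cluster_restrict_eq_self hX] at h
        exact hcX h.1
      rw [this]
      simpa [prob] using prob_nonneg hp _

/-- Given that `x` and `y` are not connected, `x ↔ c` and `y ↔ d` are negatively correlated. -/
theorem prob_disjoint_connections_mul_le (hp : G.ProbValid) (x y c d : V) (F : Finset E) :
    G.prob {ω | ¬ G.Conn (restrict F ω) x y} *
        G.prob {ω | ¬ G.Conn (restrict F ω) x y ∧ G.Conn (restrict F ω) x c ∧
          G.Conn (restrict F ω) y d} ≤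
      G.prob {ω | ¬ G.Conn (restrict F ω) x y ∧ G.Conn (restrict F ω) x c} *
        G.prob {ω | ¬ G.Conn (restrict F ω) x y ∧ G.Conn (restrict F ω) y d} := by
  have h := prob_cluster_mul_le hp y c d F {x} {x}
  have hins (ω : E → Bool) : y ∉ G.cluster (restrict F ω) {d, x} ↔
      ¬ G.Conn (restrict F ω) x y ∧ ¬ G.Conn (restrict F ω) y d := by
    have : G.Conn (restrict F ω) d y ↔ G.Conn (restrict F ω) y d := ⟨.symm, .symm⟩
    rw [Set.insert_eq, cluster_union, Set.mem_union, mem_cluster_singleton,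
      mem_cluster_singleton, this, not_or, and_comm]
  simp only [Set.union_self, Set.inter_self, hins, mem_cluster_singleton] at h
  set m := {ω | ¬ G.Conn (restrict F ω) x y}
  set u := {ω | G.Conn (restrict F ω) x c ∧ ¬ G.Conn (restrict F ω) x y} with hu
  set t := {ω | G.Conn (restrict F ω) y d}
  have h₁ := prob_inter_add_diff (G := G) m t
  have h₂ := prob_inter_add_diff (G := G) u t
  have s₁ : {ω | ¬ G.Conn (restrict F ω) x y ∧ ¬ G.Conn (restrict F ω) y d} = m \ t := rfl
  have s₂ : {ω | G.Conn (restrict F ω) x c ∧ ¬ G.Conn (restrict F ω) x y ∧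
      ¬ G.Conn (restrict F ω) y d} = u \ t := by
    ext ω; exact and_assoc.symm
  have s₃ : {ω | ¬ G.Conn (restrict F ω) x y ∧ G.Conn (restrict F ω) x c ∧
      G.Conn (restrict F ω) y d} = u ∩ t := by
    ext ω; simp only [hu, t, Set.mem_inter_iff, Set.mem_ofPred_eq]; tauto
  have s₄ : {ω | ¬ G.Conn (restrict F ω) x y ∧ G.Conn (restrict F ω) x c} = u := by
    ext ω; exact and_comm
  have s₅ : {ω | ¬ G.Conn (restrict F ω) x y ∧ G.Conn (restrict F ω) y d} = m ∩ t := rfl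
  rw [s₁, s₂, eq_sub_of_add_eq' h₁, eq_sub_of_add_eq' h₂] at h
  rw [s₃, s₄, s₅]
  linarith

lemma mem_pivotal_connEvent {e : E} {x y : V} {ω : E → Bool} :
    ω ∈ pivotal e (G.connEvent x y) ↔
      G.Conn (Function.update (restrict (Finset.univ.erase e) ω) e true) x y ∧
        ¬ G.Conn (restrict (Finset.univ.erase e) ω) x y := by
  have hr : restrict Finset.univ = (id : (E → Bool) → E → Bool) := by
    ext ω f; simp [restrict]
  have h₁ := restrict_update_true (Finset.mem_univ e) ω
  have h₂ := restrict_update_false Finset.univ e ω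
  rw [hr, id] at h₁ h₂
  have hmono : G.Conn (restrict (Finset.univ.erase e) ω) x y →
      G.Conn (Function.update (restrict (Finset.univ.erase e) ω) e true) x y :=
    Conn.mono (le_update_true _ e)
  simp only [pivotal, connEvent, Set.mem_ofPred_eq, h₁, h₂]
  tauto

lemma subset_pivotal {e : E} {v w : V} (he : G.Joins e v w) (y : V) :
    {ω | ¬ G.Conn (restrict (Finset.univ.erase e) ω) v w ∧
      G.Conn (restrict (Finset.univ.erase e) ω) w y} ⊆ pivotal e (G.connEvent v y) := by
  rintro ω ⟨h₁, h₂⟩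
  refine mem_pivotal_connEvent.2 ⟨?_, fun h => h₁ (h.trans h₂.symm)⟩
  exact .head ⟨e, by simp, he⟩ (h₂.mono (le_update_true _ e))

lemma pivotal_subset {e : E} {v w : V} (he : G.Joins e v w) (x y : V) :
    pivotal e (G.connEvent x y) ⊆
      {ω | ¬ G.Conn (restrict (Finset.univ.erase e) ω) v w ∧
        G.Conn (restrict (Finset.univ.erase e) ω) v x ∧
        G.Conn (restrict (Finset.univ.erase e) ω) w y} ∪
      {ω | ¬ G.Conn (restrict (Finset.univ.erase e) ω) w v ∧
        G.Conn (restrict (Finset.univ.erase e) ω) w x ∧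
        G.Conn (restrict (Finset.univ.erase e) ω) v y} := by
  intro ω hω
  obtain ⟨h₁, h₂⟩ := mem_pivotal_connEvent.1 hω
  rcases conn_update_true he h₁ with h | h | h
  · exact absurd h h₂
  · exact Or.inl ⟨fun hvw => h₂ ((h.1.symm.trans hvw).trans h.2), h⟩
  · exact Or.inr ⟨fun hwv => h₂ ((h.1.symm.trans hwv).trans h.2), h⟩

end PercGraph

open PercGraph in
/-- pivotality comparison: for an edge `e` with endpoints `a₁, a₂`,
`max_{j=1,2} P(e pivotal for aⱼ↔b) ≥ P(e pivotal for a₃↔b)`. -/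
theorem pivotal_comparison
    {V E : Type} [DecidableEq V] [Fintype E] [DecidableEq E]
    (G : PercGraph V E) (hp : G.ProbValid) (a₁ a₂ a₃ b : V)
    (e : E) (he : G.ends e = (a₁, a₂)) :
    G.prob (PercGraph.pivotal e (G.connEvent a₃ b))
      ≤ max (G.prob (PercGraph.pivotal e (G.connEvent a₁ b)))
            (G.prob (PercGraph.pivotal e (G.connEvent a₂ b))) := by
  have he₁ : G.Joins e a₁ a₂ := Or.inl he
  have he₂ : G.Joins e a₂ a₁ := Or.inr he
  have hx := (prob_mono hp (pivotal_subset he₁ a₃ b)).trans (prob_union_le hp _ _)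
  have hr₁ := (prob_mono hp (subset_pivotal he₁ b)).trans (le_max_left _
    (G.prob (PercGraph.pivotal e (G.connEvent a₂ b))))
  have hr₂ := (prob_mono hp (subset_pivotal he₂ b)).trans (le_max_right
    (G.prob (PercGraph.pivotal e (G.connEvent a₁ b))) _)
  set F := Finset.univ.erase e
  have k₁ := prob_disjoint_connections_mul_le hp a₁ a₂ a₃ b F
  have k₂ := prob_disjoint_connections_mul_le hp a₂ a₁ a₃ b F
  set M := max (G.prob (PercGraph.pivotal e (G.connEvent a₁ b)))
    (G.prob (PercGraph.pivotal e (G.connEvent a₂ b)))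
  have hM : 0 ≤ M := (prob_nonneg hp _).trans hr₁
  have hcomm (ω : E → Bool) : G.Conn (restrict F ω) a₂ a₁ ↔ G.Conn (restrict F ω) a₁ a₂ :=
    ⟨.symm, .symm⟩
  simp only [hcomm] at k₂ hx hr₂
  have hu : G.prob {ω | ¬ G.Conn (restrict F ω) a₁ a₂ ∧ G.Conn (restrict F ω) a₁ a₃} +
      G.prob {ω | ¬ G.Conn (restrict F ω) a₁ a₂ ∧ G.Conn (restrict F ω) a₂ a₃} ≤
      G.prob {ω | ¬ G.Conn (restrict F ω) a₁ a₂} := by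
    rw [← prob_inter_add_diff {ω | ¬ G.Conn (restrict F ω) a₁ a₂}
      {ω | G.Conn (restrict F ω) a₁ a₃}]
    exact add_le_add le_rfl
      (prob_mono hp fun ω h => ⟨h.1, fun h' => h.1 (h'.trans h.2.symm)⟩)
  have hm₁ : G.prob {ω | ¬ G.Conn (restrict F ω) a₁ a₂ ∧ G.Conn (restrict F ω) a₁ a₃ ∧
      G.Conn (restrict F ω) a₂ b} ≤ G.prob {ω | ¬ G.Conn (restrict F ω) a₁ a₂} :=
    prob_mono hp fun ω h => h.1
  have hm₂ : G.prob {ω | ¬ G.Conn (restrict F ω) a₁ a₂ ∧ G.Conn (restrict F ω) a₂ a₃ ∧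
      G.Conn (restrict F ω) a₁ b} ≤ G.prob {ω | ¬ G.Conn (restrict F ω) a₁ a₂} :=
    prob_mono hp fun ω h => h.1
  refine hx.trans ?_
  rcases (prob_nonneg hp {ω | ¬ G.Conn (restrict F ω) a₁ a₂}).eq_or_lt with h | h
  · linarith
  · refine le_of_mul_le_mul_left ?_ h
    have l₁ := mul_le_mul_of_nonneg_left hr₁
      (prob_nonneg hp {ω | ¬ G.Conn (restrict F ω) a₁ a₂ ∧ G.Conn (restrict F ω) a₁ a₃})
    have l₂ := mul_le_mul_of_nonneg_left hr₂
      (prob_nonneg hp {ω | ¬ G.Conn (restrict F ω) a₁ a₂ ∧ G.Conn (restrict F ω) a₂ a₃})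
    have l₃ := mul_le_mul_of_nonneg_right hu hM
    linarith
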